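/- Fix K < ∞ and let {(ψⁿ, Pⁿ)}_{n≥1} be a sequence such that each (ψⁿ, Pⁿ) is a viable pair (for Regime 2 with initial point x₀) and ∫ ‖z‖² Pⁿ(dz dy dt) < K for every n. Then {(ψⁿ, Pⁿ)} is precompact in C([0,1]; ℝ^d) × 𝒫(ℝ^d × 𝕋^d × [0,1]): every subsequence has a further subsequence along which ψⁿ converges uniformly on [0,1] and Pⁿ converges weakly to some Borel probability measure. -/

import Mathlib

open MeasureTheory Matrix Filter

noncomputable section

/-- The control space `Z = ℝ^d`. -/
abbrev Ctrl (d : ℕ) := Fin d → ℝ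

/-- The `d`-dimensional torus `𝕋^d = ℝ^d/ℤ^d`. -/
abbrev Torus (d : ℕ) := Fin d → AddCircle (1 : ℝ)

/-- The time interval `[0,1]`. -/
abbrev I01 := Set.Icc (0 : ℝ) 1

/-- The space `ℝ^d × 𝕋^d × [0,1]` on which occupation measures live. -/
abbrev Spc (d : ℕ) := Ctrl d × Torus d × I01

/-- The canonical projection `ℝ^d → 𝕋^d`. -/
def torusProj (d : ℕ) (w : Fin d → ℝ) : Torus d := fun i => (w i : AddCircle (1 : ℝ))

/-- `λ₂(x,y,z) = γ b(x,y) + c(x,y) + σ(x,y) z`. -/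
def lam2 {d : ℕ} (γ : ℝ) (b c : (Fin d → ℝ) → Torus d → Fin d → ℝ)
    (σ : (Fin d → ℝ) → Torus d → Matrix (Fin d) (Fin d) ℝ)
    (x : Fin d → ℝ) (y : Torus d) (z : Ctrl d) : Fin d → ℝ :=
  fun i => γ * b x y i + c x y i + (σ x y).mulVec z i

/-- A function `F : ℝ^d → ℝ` is a `C²` representative of a test function on the torus
if it is twice continuously differentiable and `ℤ^d`-periodic. -/
def IsC2Periodic {d : ℕ} (F : (Fin d → ℝ) → ℝ) : Prop :=
  ContDiff ℝ 2 F ∧ ∀ (w : Fin d → ℝ) (m : Fin d → ℤ), F (w + fun i => (m i : ℝ)) = F w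

/-- The generator `ℒ²_{z,x} f(y)`, expressed through a periodic representative
`F = f ∘ π` on `ℝ^d`:
`ℒ²_{z,x}F(w) = λ₂(x, π w, z)·∇F(w) + (γ/2) Σ_{ij} (σσᵀ)_{ij}(x, π w) ∂²F(w)/∂w_i∂w_j`. -/
def gen2 {d : ℕ} (γ : ℝ) (b c : (Fin d → ℝ) → Torus d → Fin d → ℝ)
    (σ : (Fin d → ℝ) → Torus d → Matrix (Fin d) (Fin d) ℝ)
    (x : Fin d → ℝ) (z : Ctrl d) (F : (Fin d → ℝ) → ℝ) (w : Fin d → ℝ) : ℝ :=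
  (∑ i, lam2 γ b c σ x (torusProj d w) z i * fderiv ℝ F w (Pi.single i 1)) +
    (γ / 2) * ∑ i, ∑ j, (σ x (torusProj d w) * (σ x (torusProj d w))ᵀ) i j *
      fderiv ℝ (fun v => fderiv ℝ F v (Pi.single j 1)) w (Pi.single i 1)

/-- A pair `(ψ, P)`, with `ψ ∈ C([0,1]; ℝ^d)` and `P` a Borel probability measure on
`ℝ^d × 𝕋^d × [0,1]`, is *viable* (for Regime 2 with initial point `x₀`) if
`P` has finite second moment in `z`, `ψ_t = x₀ + ∫_{ℝ^d×𝕋^d×[0,t]} λ₂(ψ_s,y,z) dP`,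
`∫_{ℝ^d×𝕋^d×[0,t]} ℒ²_{z,ψ_s} f(y) dP = 0` for every `f ∈ C²(𝕋^d)` and `t ∈ [0,1]`,
and the last marginal of `P` is Lebesgue measure. -/
def IsViablePair {d : ℕ} (γ : ℝ) (x₀ : Fin d → ℝ)
    (b c : (Fin d → ℝ) → Torus d → Fin d → ℝ)
    (σ : (Fin d → ℝ) → Torus d → Matrix (Fin d) (Fin d) ℝ)
    (ψ : C(I01, Fin d → ℝ)) (P : Measure (Spc d)) : Prop :=
  IsProbabilityMeasure P ∧
  Integrable (fun p : Spc d => ∑ i, (p.1 i) ^ 2) P ∧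
  (∀ t : I01, ψ t = fun i => x₀ i +
      ∫ p in {p : Spc d | (p.2.2 : ℝ) ≤ (t : ℝ)}, lam2 γ b c σ (ψ p.2.2) p.2.1 p.1 i ∂P) ∧
  (∀ F : (Fin d → ℝ) → ℝ, IsC2Periodic F →
    ∀ g : Spc d → ℝ,
      (∀ (z : Ctrl d) (w : Fin d → ℝ) (s : I01), g (z, torusProj d w, s) = gen2 γ b c σ (ψ s) z F w) →
      ∀ t : I01, ∫ p in {p : Spc d | (p.2.2 : ℝ) ≤ (t : ℝ)}, g p ∂P = 0) ∧
  (∀ t : I01, P {p : Spc d | (p.2.2 : ℝ) ≤ (t : ℝ)} = ENNReal.ofReal t)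

end

theorem isOpenQuotientMap_torusProj (d : ℕ) : IsOpenQuotientMap (torusProj d) where
  surjective y :=
    ⟨fun i => (QuotientAddGroup.mk_surjective (y i)).choose,
      funext fun i => (QuotientAddGroup.mk_surjective (y i)).choose_spec⟩
  continuous := continuous_pi fun i =>
    (AddCircle.continuous_mk' (1 : ℝ)).comp (continuous_apply i)
  isOpenMap := IsOpenMap.piMap (f := fun _ : Fin d => ((↑) : ℝ → AddCircle (1 : ℝ)))
    (fun _ => QuotientAddGroup.isOpenMap_coe)
    (Eventually.of_forall fun _ => QuotientAddGroup.mk_surjective)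

/-- Continuity on `ℝ^d × 𝕋^d` may be checked on periodic representatives. -/
theorem continuous_uncurry_of_comp_torusProj {d : ℕ} {f : (Fin d → ℝ) → Torus d → ℝ}
    (hf : Continuous fun p : (Fin d → ℝ) × (Fin d → ℝ) => f p.1 (torusProj d p.2)) :
    Continuous fun p : (Fin d → ℝ) × Torus d => f p.1 p.2 :=
  ((IsOpenQuotientMap.id.prodMap
    (isOpenQuotientMap_torusProj d)).continuous_comp_iff).1 hf

theorem continuous_lam2_comp {d : ℕ} {γ : ℝ} {b c : (Fin d → ℝ) → Torus d → Fin d → ℝ}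
    {σ : (Fin d → ℝ) → Torus d → Matrix (Fin d) (Fin d) ℝ}
    (hb : ∀ i, Continuous fun p : (Fin d → ℝ) × Torus d => b p.1 p.2 i)
    (hc : ∀ i, Continuous fun p : (Fin d → ℝ) × Torus d => c p.1 p.2 i)
    (hσ : ∀ i j, Continuous fun p : (Fin d → ℝ) × Torus d => σ p.1 p.2 i j)
    (ψ : C(I01, Fin d → ℝ)) (i : Fin d) :
    Continuous fun p : Spc d => lam2 γ b c σ (ψ p.2.2) p.2.1 p.1 i := by
  have hp : Continuous fun p : Spc d => (ψ p.2.2, p.2.1) := by fun_prop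
  have hb' := (hb i).comp hp
  have hc' := (hc i).comp hp
  have hσ' := fun j => (hσ i j).comp hp
  simp only [Function.comp_def] at hb' hc' hσ'
  simp only [lam2, Matrix.mulVec, dotProduct]
  fun_prop

theorem abs_lam2_le {d : ℕ} {γ M : ℝ} {b c : (Fin d → ℝ) → Torus d → Fin d → ℝ}
    {σ : (Fin d → ℝ) → Torus d → Matrix (Fin d) (Fin d) ℝ} (hγ : 0 < γ)
    (hb : ∀ x y i, |b x y i| ≤ M) (hc : ∀ x y i, |c x y i| ≤ M)
    (hσ : ∀ x y i j, |σ x y i j| ≤ M) {δ : ℝ} (hδ : 0 < δ)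
    (x : Fin d → ℝ) (y : Torus d) (z : Ctrl d) (i : Fin d) :
    |lam2 γ b c σ x y z i| ≤ (γ * M + M + d * (M / δ)) + M * δ * ∑ j, (z j) ^ 2 := by
  have hM : 0 ≤ M := (abs_nonneg _).trans (hb x y i)
  have hz : ∀ j, |z j| ≤ 1 / δ + δ * z j ^ 2 := fun j => by
    rw [div_add' _ _ _ hδ.ne', le_div_iff₀ hδ, ← sq_abs (z j)]
    nlinarith [sq_nonneg (|z j| * δ - 1), sq_nonneg (|z j| * δ)]
  have hsum : |(σ x y).mulVec z i| ≤ d * (M / δ) + M * δ * ∑ j, (z j) ^ 2 := by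
    calc |(σ x y).mulVec z i| ≤ ∑ j, |σ x y i j * z j| := by
          simpa only [Matrix.mulVec, dotProduct] using
            Finset.abs_sum_le_sum_abs (fun j => σ x y i j * z j) Finset.univ
      _ ≤ ∑ j, M * (1 / δ + δ * z j ^ 2) := Finset.sum_le_sum fun j _ => by
          rw [abs_mul]
          exact mul_le_mul (hσ x y i j) (hz j) (abs_nonneg _) hM
      _ = d * (M / δ) + M * δ * ∑ j, (z j) ^ 2 := by
          simp only [mul_add, Finset.sum_add_distrib, Finset.mul_sum, Finset.sum_const,
            Finset.card_univ, Fintype.card_fin, nsmul_eq_mul, mul_assoc, mul_one_div]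
  have hγb : |γ * b x y i| ≤ γ * M := by
    rw [abs_mul, abs_of_pos hγ]
    exact mul_le_mul_of_nonneg_left (hb x y i) hγ.le
  calc |lam2 γ b c σ x y z i|
      ≤ |γ * b x y i| + |c x y i| + |(σ x y).mulVec z i| := abs_add_three _ _ _
    _ ≤ _ := by linarith [hc x y i]

theorem abs_setIntegral_le_of_abs_le_add {α : Type*} [MeasurableSpace α] {μ : Measure α}
    [IsFiniteMeasure μ] {f q : α → ℝ} {A B : ℝ} (hB : 0 ≤ B) (hq : Integrable q μ)
    (hq0 : ∀ p, 0 ≤ q p) (hfq : ∀ p, |f p| ≤ A + B * q p) (S : Set α) :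
    |∫ p in S, f p ∂μ| ≤ A * μ.real S + B * ∫ p, q p ∂μ := by
  calc |∫ p in S, f p ∂μ| ≤ ∫ p in S, (A + B * q p) ∂μ :=
        norm_integral_le_of_norm_le (f := f) (g := fun p => A + B * q p)
          (((integrable_const A).add (hq.const_mul B)).integrableOn)
          (Eventually.of_forall hfq)
    _ = A * μ.real S + B * ∫ p in S, q p ∂μ := by
        rw [integral_add (integrable_const A) (hq.const_mul B).integrableOn,
          integral_const_mul, setIntegral_const, smul_eq_mul, mul_comm A]
    _ ≤ _ := by
        gcongr A * μ.real S + B * ?_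
        exact setIntegral_le_integral hq (Eventually.of_forall hq0)

theorem measurableSet_time_le (d : ℕ) (t : I01) :
    MeasurableSet {p : Spc d | (p.2.2 : ℝ) ≤ (t : ℝ)} := by
  refine (isClosed_le ?_ continuous_const).measurableSet
  fun_prop

/-- The basic a priori estimate: every `δ > 0` yields a bound on the increments of `ψ` in a
viable pair that is linear in time up to an error proportional to `δ`. -/
theorem IsViablePair.abs_sub_le {d : ℕ} {γ M K : ℝ} {x₀ : Fin d → ℝ}
    {b c : (Fin d → ℝ) → Torus d → Fin d → ℝ}
    {σ : (Fin d → ℝ) → Torus d → Matrix (Fin d) (Fin d) ℝ} (hγ : 0 < γ)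
    (hbM : ∀ x y i, |b x y i| ≤ M) (hcM : ∀ x y i, |c x y i| ≤ M)
    (hσM : ∀ x y i j, |σ x y i j| ≤ M)
    (hb : ∀ i, Continuous fun p : (Fin d → ℝ) × Torus d => b p.1 p.2 i)
    (hc : ∀ i, Continuous fun p : (Fin d → ℝ) × Torus d => c p.1 p.2 i)
    (hσ : ∀ i j, Continuous fun p : (Fin d → ℝ) × Torus d => σ p.1 p.2 i j)
    {ψ : C(I01, Fin d → ℝ)} {P : Measure (Spc d)} (h : IsViablePair γ x₀ b c σ ψ P)
    (hK : ∫ p, ∑ i, (p.1 i) ^ 2 ∂P < K) {δ : ℝ} (hδ : 0 < δ) {s t : I01} (hst : s ≤ t)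
    (i : Fin d) :
    |ψ t i - ψ s i| ≤ (γ * M + M + d * (M / δ)) * (t - s) + M * δ * K := by
  obtain ⟨hP, hsq, hψ, -, htime⟩ := h
  have hM : 0 ≤ M := (abs_nonneg _).trans (hbM 0 0 i)
  have hB : 0 ≤ M * δ := by positivity
  set f : Spc d → ℝ := fun p => lam2 γ b c σ (ψ p.2.2) p.2.1 p.1 i with hf
  have hle : ∀ p, |f p| ≤ (γ * M + M + d * (M / δ)) + M * δ * ∑ j, (p.1 j) ^ 2 :=
    fun p => abs_lam2_le hγ hbM hcM hσM hδ _ _ _ _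
  have hfint : Integrable f P :=
    ((integrable_const _).add (hsq.const_mul (M * δ))).mono'
      (continuous_lam2_comp hb hc hσ ψ i).aestronglyMeasurable (Eventually.of_forall hle)
  have hsub : {p : Spc d | (p.2.2 : ℝ) ≤ (s : ℝ)} ⊆ {p : Spc d | (p.2.2 : ℝ) ≤ (t : ℝ)} :=
    fun p hp => le_trans hp hst
  have hdiff : ψ t i - ψ s i = ∫ p in {p : Spc d | (p.2.2 : ℝ) ≤ (t : ℝ)} \
      {p : Spc d | (p.2.2 : ℝ) ≤ (s : ℝ)}, f p ∂P := by
    rw [setIntegral_sdiff (measurableSet_time_le d s) hfint.integrableOn hsub, hψ t, hψ s]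
    ring
  have hreal : ∀ r : I01, P.real {p : Spc d | (p.2.2 : ℝ) ≤ (r : ℝ)} = r := fun r => by
    rw [measureReal_def, htime, ENNReal.toReal_ofReal r.2.1]
  rw [hdiff]
  refine (abs_setIntegral_le_of_abs_le_add hB hsq
    (fun p => Finset.sum_nonneg fun j _ => sq_nonneg _) hle _).trans ?_
  rw [measureReal_sdiff hsub (measurableSet_time_le d s), hreal, hreal]
  gcongr

theorem IsViablePair.abs_sub_initial_le {d : ℕ} {γ M K : ℝ} {x₀ : Fin d → ℝ}
    {b c : (Fin d → ℝ) → Torus d → Fin d → ℝ}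
    {σ : (Fin d → ℝ) → Torus d → Matrix (Fin d) (Fin d) ℝ} (hγ : 0 < γ)
    (hbM : ∀ x y i, |b x y i| ≤ M) (hcM : ∀ x y i, |c x y i| ≤ M)
    (hσM : ∀ x y i j, |σ x y i j| ≤ M)
    {ψ : C(I01, Fin d → ℝ)} {P : Measure (Spc d)} (h : IsViablePair γ x₀ b c σ ψ P)
    (hK : ∫ p, ∑ i, (p.1 i) ^ 2 ∂P < K) (t : I01) (i : Fin d) :
    |ψ t i - x₀ i| ≤ (γ * M + M + d * M) + M * K := by
  obtain ⟨hP, hsq, hψ, -, -⟩ := h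
  have hM : 0 ≤ M := (abs_nonneg _).trans (hbM 0 0 i)
  rw [hψ t, add_sub_cancel_left]
  refine (abs_setIntegral_le_of_abs_le_add hM hsq
    (fun p => Finset.sum_nonneg fun j _ => sq_nonneg _)
    (fun p => by simpa using abs_lam2_le hγ hbM hcM hσM one_pos _ _ _ _) _).trans ?_
  gcongr
  exact mul_le_of_le_one_right (by positivity) measureReal_le_one

/-- A uniform second moment bound on the control variable forces tightness, the remaining
variables living in a compact space. -/
theorem isTightMeasureSet_of_integral_sq_lt {d : ℕ} {K : ℝ} {S : Set (Measure (Spc d))}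
    (hsq : ∀ P ∈ S, Integrable (fun p : Spc d => ∑ i, (p.1 i) ^ 2) P)
    (hK : ∀ P ∈ S, ∫ p, ∑ i, (p.1 i) ^ 2 ∂P < K) (hfin : ∀ P ∈ S, IsFiniteMeasure P) :
    IsTightMeasureSet S := by
  rw [isTightMeasureSet_iff_exists_isCompact_measure_compl_le]
  intro ε hε
  rcases S.eq_empty_or_nonempty with rfl | ⟨P₀, hP₀⟩
  · exact ⟨∅, isCompact_empty, by simp⟩
  have hK0 : 0 < K := (integral_nonneg fun p =>
    Finset.sum_nonneg fun j _ => sq_nonneg _).trans_lt (hK P₀ hP₀)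
  obtain ⟨e, he0, heε⟩ : ∃ e : ℝ, 0 < e ∧ ENNReal.ofReal e ≤ ε := by
    obtain ⟨r, hr0, hrε⟩ := ENNReal.lt_iff_exists_nnreal_btwn.1 hε
    exact ⟨r, by exact_mod_cast hr0, by simpa using hrε.le⟩
  have hR : 0 < K / e := by positivity
  refine ⟨{p : Spc d | ∑ i, (p.1 i) ^ 2 ≤ K / e}, ?_, fun P hP => ?_⟩
  · refine ((isCompact_closedBall (0 : Ctrl d) (√(K / e))).prod
      (isCompact_univ (X := Torus d × I01))).of_isClosed_subset
      (isClosed_le (by fun_prop) continuous_const) fun p hp => ⟨?_, Set.mem_univ _⟩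
    rw [mem_closedBall_zero_iff, pi_norm_le_iff_of_nonneg (Real.sqrt_nonneg _)]
    exact fun i => Real.abs_le_sqrt ((Finset.single_le_sum (f := fun i => p.1 i ^ 2)
      (fun j _ => sq_nonneg _) (Finset.mem_univ i)).trans hp)
  · have := hfin P hP
    have hmarkov := mul_meas_ge_le_integral_of_nonneg (μ := P) (Eventually.of_forall fun p =>
      Finset.sum_nonneg fun j _ => sq_nonneg _) (hsq P hP) (K / e)
    have hreal : P.real {p : Spc d | ∑ i, (p.1 i) ^ 2 ≤ K / e}ᶜ ≤ e := by
      refine (measureReal_mono (s₂ := {p : Spc d | K / e ≤ ∑ i, (p.1 i) ^ 2})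
        fun p hp => le_of_lt (by simpa using hp)).trans
        (le_of_mul_le_mul_left (hmarkov.trans ?_) hR)
      rw [div_mul_cancel₀ _ he0.ne']
      exact (hK P hP).le
    refine le_trans ?_ heε
    rw [← ofReal_measureReal]
    exact ENNReal.ofReal_le_ofReal hreal

open BoundedContinuousFunction in
/-- Arzelà–Ascoli for sequences: a uniformly bounded, uniformly equicontinuous sequence of
paths has a uniformly convergent subsequence. -/
theorem exists_subseq_tendstoUniformly {X E : Type*} [PseudoMetricSpace X] [CompactSpace X]
    [MetricSpace E] [ProperSpace E] (f : ℕ → C(X, E)) (x₀ : E) (R : ℝ)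
    (hR : ∀ n t, dist (f n t) x₀ ≤ R)
    (hf : ∀ ε > 0, ∃ η > 0, ∀ n s t, dist s t < η → dist (f n s) (f n t) < ε) :
    ∃ φ : ℕ → ℕ, StrictMono φ ∧ ∃ g : C(X, E),
      TendstoUniformly (fun n => ⇑(f (φ n))) (⇑g) atTop := by
  have hcomp := arzela_ascoli (Metric.closedBall x₀ R) (isCompact_closedBall x₀ R)
    (Set.range fun n => mkOfCompact (f n))
    (by rintro _ t ⟨n, rfl⟩; exact hR n t)
    (UniformEquicontinuous.equicontinuous (Metric.uniformEquicontinuous_iff.2 fun ε hε => by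
      obtain ⟨η, hη, h⟩ := hf ε hε
      refine ⟨η, hη, fun s t hst => ?_⟩
      rintro ⟨_, n, rfl⟩
      exact h n s t hst))
  obtain ⟨g, -, φ, hφ, hlim⟩ := hcomp.tendsto_subseq
    (x := fun n => mkOfCompact (f n)) (fun n => subset_closure ⟨n, rfl⟩)
  exact ⟨φ, hφ, g.toContinuousMap, tendsto_iff_tendstoUniformly.1 hlim⟩

open BoundedContinuousFunction in
/-- **Precompactness of viable pairs** (Lemma on equicontinuity/precompactness,
Regime 2).  If each `(ψⁿ, Pⁿ)` is viable with `∫‖z‖² dPⁿ < K`, then every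
subsequence has a further subsequence along which `ψⁿ` converges uniformly on
`[0,1]` and `Pⁿ` converges weakly to a Borel probability measure. -/
theorem viablePairs_precompact {d : ℕ} (hd : 1 ≤ d) (γ : ℝ) (hγ : 0 < γ)
    (x₀ : Fin d → ℝ)
    (b c : (Fin d → ℝ) → Torus d → Fin d → ℝ)
    (σ : (Fin d → ℝ) → Torus d → Matrix (Fin d) (Fin d) ℝ)
    -- boundedness of the coefficients
    (hbB : ∃ M, ∀ x y i, |b x y i| ≤ M) (hcB : ∃ M, ∀ x y i, |c x y i| ≤ M)
    (hσB : ∃ M, ∀ x y i j, |σ x y i j| ≤ M)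
    -- Lipschitz continuity of the coefficients (via periodic representatives)
    (hbL : ∃ L : NNReal, ∀ i, LipschitzWith L
      (fun p : (Fin d → ℝ) × (Fin d → ℝ) => b p.1 (torusProj d p.2) i))
    (hcL : ∃ L : NNReal, ∀ i, LipschitzWith L
      (fun p : (Fin d → ℝ) × (Fin d → ℝ) => c p.1 (torusProj d p.2) i))
    (hσL : ∃ L : NNReal, ∀ i j, LipschitzWith L
      (fun p : (Fin d → ℝ) × (Fin d → ℝ) => σ p.1 (torusProj d p.2) i j))
    -- uniform nondegeneracy of `σσᵀ`
    (hnd : ∃ θ > (0 : ℝ), ∀ x y (ξ : Fin d → ℝ),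
      θ * ∑ i, (ξ i) ^ 2 ≤ ξ ⬝ᵥ (σ x y * (σ x y)ᵀ).mulVec ξ)
    (K : ℝ)
    (ψs : ℕ → C(I01, Fin d → ℝ)) (Ps : ℕ → Measure (Spc d))
    (hviable : ∀ n, IsViablePair γ x₀ b c σ (ψs n) (Ps n))
    (hK : ∀ n, ∫ p, ∑ i, (p.1 i) ^ 2 ∂(Ps n) < K) :
    ∀ φ : ℕ → ℕ, StrictMono φ →
      ∃ φ' : ℕ → ℕ, StrictMono φ' ∧
        ∃ (ψ : C(I01, Fin d → ℝ)) (P : Measure (Spc d)), IsProbabilityMeasure P ∧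
          TendstoUniformly (fun n => ⇑(ψs (φ (φ' n)))) (⇑ψ) Filter.atTop ∧
          ∀ g : Spc d →ᵇ ℝ,
            Filter.Tendsto (fun n => ∫ p, g p ∂(Ps (φ (φ' n)))) Filter.atTop
              (nhds (∫ p, g p ∂P)) := by
  intro φ _
  obtain ⟨Mb, hMb⟩ := hbB
  obtain ⟨Mc, hMc⟩ := hcB
  obtain ⟨Mσ, hMσ⟩ := hσB
  obtain ⟨M, hM0, hbM, hcM, hσM⟩ : ∃ M : ℝ, 0 < M ∧ (∀ x y i, |b x y i| ≤ M) ∧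
      (∀ x y i, |c x y i| ≤ M) ∧ ∀ x y i j, |σ x y i j| ≤ M := by
    refine ⟨1 + |Mb| + |Mc| + |Mσ|, by positivity, fun x y i => ?_, fun x y i => ?_,
      fun x y i j => ?_⟩
    · linarith [hMb x y i, le_abs_self Mb, abs_nonneg Mc, abs_nonneg Mσ]
    · linarith [hMc x y i, le_abs_self Mc, abs_nonneg Mb, abs_nonneg Mσ]
    · linarith [hMσ x y i j, le_abs_self Mσ, abs_nonneg Mb, abs_nonneg Mc]
  have hb : ∀ i, Continuous fun p : (Fin d → ℝ) × Torus d => b p.1 p.2 i := fun i =>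
    continuous_uncurry_of_comp_torusProj (f := fun x y => b x y i) (hbL.choose_spec i).continuous
  have hc : ∀ i, Continuous fun p : (Fin d → ℝ) × Torus d => c p.1 p.2 i := fun i =>
    continuous_uncurry_of_comp_torusProj (f := fun x y => c x y i) (hcL.choose_spec i).continuous
  have hσ : ∀ i j, Continuous fun p : (Fin d → ℝ) × Torus d => σ p.1 p.2 i j := fun i j =>
    continuous_uncurry_of_comp_torusProj (f := fun x y => σ x y i j)
      (hσL.choose_spec i j).continuous
  have hK0 : 0 < K := (integral_nonneg fun p =>
    Finset.sum_nonneg fun j _ => sq_nonneg _).trans_lt (hK 0)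
  -- uniform convergence of the paths
  obtain ⟨φ₁, hφ₁, ψ, hψ⟩ := exists_subseq_tendstoUniformly (fun n => ψs (φ n)) x₀
    ((γ * M + M + d * M) + M * K)
    (fun n t => (dist_pi_le_iff (by positivity)).2 fun i =>
      (hviable (φ n)).abs_sub_initial_le hγ hbM hcM hσM (hK (φ n)) t i)
    (fun ε hε => by
      set δ : ℝ := ε / (4 * (M * K)) with hδ
      have hδ0 : 0 < δ := by positivity
      have hδε : M * δ * K = ε / 4 := by rw [hδ]; field_simp
      set A : ℝ := γ * M + M + d * (M / δ) with hA
      have hA0 : 0 < A := by positivity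
      have key : ∀ n (s t : I01), s ≤ t → dist s t < ε / (4 * A) →
          dist (ψs (φ n) s) (ψs (φ n) t) < ε := by
        intro n s t hst hdist
        have hts : A * ((t : ℝ) - s) ≤ ε / 4 := by
          have : (t : ℝ) - s ≤ ε / (4 * A) := by
            rw [Subtype.dist_eq, Real.dist_eq, abs_sub_comm] at hdist
            exact (le_abs_self _).trans hdist.le
          calc A * ((t : ℝ) - s) ≤ A * (ε / (4 * A)) := by gcongr
            _ = ε / 4 := by field_simp
        refine (dist_pi_lt_iff hε).2 fun i => ?_
        rw [dist_comm, Real.dist_eq]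
        have := (hviable (φ n)).abs_sub_le hγ hbM hcM hσM hb hc hσ (hK (φ n)) hδ0 hst i
        rw [hδε] at this
        linarith
      refine ⟨ε / (4 * A), by positivity, fun n s t hdist => ?_⟩
      rcases le_total s t with hst | hst
      · exact key n s t hst hdist
      · rw [dist_comm] at hdist ⊢
        exact key n t s hst hdist)
  -- weak convergence of the measures
  set μ : ℕ → ProbabilityMeasure (Spc d) := fun n => ⟨Ps n, (hviable n).1⟩ with hμ
  have hcomp : IsCompact (closure (Set.range μ)) := by
    refine isCompact_closure_of_isTightMeasureSet
      (isTightMeasureSet_of_integral_sq_lt (K := K) ?_ ?_ ?_)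
    · rintro _ ⟨_, ⟨n, rfl⟩, rfl⟩
      exact (hviable n).2.1
    · rintro _ ⟨_, ⟨n, rfl⟩, rfl⟩
      exact hK n
    · rintro _ ⟨_, ⟨n, rfl⟩, rfl⟩
      infer_instance
  obtain ⟨P, -, φ₂, hφ₂, hP⟩ := hcomp.tendsto_subseq (x := fun n => μ (φ (φ₁ n)))
    (fun n => subset_closure ⟨_, rfl⟩)
  refine ⟨φ₁ ∘ φ₂, hφ₁.comp hφ₂, ψ, P, inferInstance, ?_, ?_⟩
  · exact fun u hu => hφ₂.tendsto_atTop.eventually (hψ u hu)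
  · exact ProbabilityMeasure.tendsto_iff_forall_integral_tendsto.1 hP
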